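/- Let m be a positive integer, ζ ∈ ℂ a primitive m-th root of unity, and x ∈ ℂ with x ≠ 0. Then x^{m(m−1)/2} · (1 − x)^m · D_ζ(x) · D_ζ(1/x) = (−1)^{m(m−1)/2} · ζ^{∑_{t=1}^{m−1} t²} · (1 − x^m)^m. -/

import Mathlib

/-- The cyclic quantum dilogarithm `D_ζ(x) = ∏_{t=1}^{m-1} (1 - ζ^t x)^t`. -/
noncomputable def cyclicDilog (m : ℕ) (ζ x : ℂ) : ℂ :=
  ∏ t ∈ Finset.Icc 1 (m - 1), (1 - ζ ^ t * x) ^ t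

theorem IsPrimitiveRoot.one_sub_pow_eq_prod_range {R : Type*} [CommRing R] [IsDomain R]
    {m : ℕ} {ζ : R} (hζ : IsPrimitiveRoot ζ m) (hm : 0 < m) (x : R) :
    1 - x ^ m = ∏ t ∈ Finset.range m, (1 - ζ ^ t * x) := by
  simpa [Polynomial.eval_prod] using
    congrArg (Polynomial.eval 1) (X_pow_sub_C_eq_prod hζ hm (rfl : x ^ m = x ^ m))

theorem IsPrimitiveRoot.one_sub_pow_eq_mul_prod_Icc {R : Type*} [CommRing R] [IsDomain R]
    {m : ℕ} {ζ : R} (hζ : IsPrimitiveRoot ζ m) (hm : 0 < m) (x : R) :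
    1 - x ^ m = (1 - x) * ∏ t ∈ Finset.Icc 1 (m - 1), (1 - ζ ^ t * x) := by
  rw [hζ.one_sub_pow_eq_prod_range hm, Finset.prod_range_eq_mul_Ico _ hm]
  have h : Finset.Ico 1 m = Finset.Icc 1 (m - 1) := by
    ext t
    simp only [Finset.mem_Ico, Finset.mem_Icc]
    lia
  simp [h]

theorem Finset.sum_Icc_one_sub_one_id (m : ℕ) :
    ∑ t ∈ Finset.Icc 1 (m - 1), t = m * (m - 1) / 2 := by
  rw [← Finset.sum_range_id]
  refine Finset.sum_subset_zero_on_sdiff ?_ ?_ (fun _ _ => rfl)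
  · intro t ht
    simp only [Finset.mem_Icc, Finset.mem_range] at *
    lia
  · intro t ht
    simp only [Finset.mem_sdiff, Finset.mem_Icc, Finset.mem_range] at ht
    lia

theorem pow_mul_cyclicDilog_inv {m : ℕ} {ζ x : ℂ} (hζ : ζ ^ m = 1) (hx : x ≠ 0) :
    x ^ (m * (m - 1) / 2) * cyclicDilog m ζ x⁻¹ =
      (-1 : ℂ) ^ (m * (m - 1) / 2) * ζ ^ (∑ t ∈ Finset.Icc 1 (m - 1), t ^ 2) *
        ∏ t ∈ Finset.Icc 1 (m - 1), (1 - ζ ^ t * x) ^ (m - t) := by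
  have reflect : ∏ t ∈ Finset.Icc 1 (m - 1), (1 - ζ ^ t * x) ^ (m - t) =
      ∏ t ∈ Finset.Icc 1 (m - 1), (1 - ζ ^ (m - t) * x) ^ t := by
    refine Finset.prod_bij' (fun t _ => m - t) (fun t _ => m - t) ?_ ?_ ?_ ?_ ?_ <;>
      intro t ht <;> simp only [Finset.mem_Icc] at *
    any_goals lia
    rw [show m - (m - t) = t by lia]
  rw [reflect, ← Finset.sum_Icc_one_sub_one_id, cyclicDilog, ← Finset.prod_pow_eq_pow_sum,
    ← Finset.prod_pow_eq_pow_sum, ← Finset.prod_pow_eq_pow_sum, ← Finset.prod_mul_distrib,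
    ← Finset.prod_mul_distrib, ← Finset.prod_mul_distrib]
  refine Finset.prod_congr rfl fun t ht => ?_
  rw [sq, pow_mul, ← mul_pow, ← mul_pow, ← mul_pow]
  congr 1
  have h : ζ ^ t * ζ ^ (m - t) = 1 := by
    rw [← pow_add, ← hζ]
    congr 1
    simp only [Finset.mem_Icc] at ht
    lia
  field_simp
  linear_combination -x * h

theorem stmt_8 (m : ℕ) (hm : 0 < m) (ζ : ℂ) (hζ : IsPrimitiveRoot ζ m)
    (x : ℂ) (hx : x ≠ 0) :
    x ^ (m * (m - 1) / 2) * (1 - x) ^ m * cyclicDilog m ζ x * cyclicDilog m ζ x⁻¹ =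
      (-1 : ℂ) ^ (m * (m - 1) / 2) * ζ ^ (∑ t ∈ Finset.Icc 1 (m - 1), t ^ 2) *
        (1 - x ^ m) ^ m := by
  have h : cyclicDilog m ζ x * ∏ t ∈ Finset.Icc 1 (m - 1), (1 - ζ ^ t * x) ^ (m - t) =
      (∏ t ∈ Finset.Icc 1 (m - 1), (1 - ζ ^ t * x)) ^ m := by
    rw [cyclicDilog, ← Finset.prod_mul_distrib, ← Finset.prod_pow]
    refine Finset.prod_congr rfl fun t ht => ?_
    rw [Finset.mem_Icc] at ht
    rw [← pow_add, Nat.add_sub_cancel' (by lia)]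
  rw [hζ.one_sub_pow_eq_mul_prod_Icc hm, mul_pow, ← h]
  linear_combination (1 - x) ^ m * cyclicDilog m ζ x * pow_mul_cyclicDilog_inv hζ.pow_eq_one hx
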